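/- arXiv:2309.03094 — 6 statements merged into one kernel-verified Lean document; each statement's English description precedes it below -/
import Mathlib

section
/- For all 0 < μ₁ ≤ μ₂ and all z ∈ ℝ, the derivatives of the smoothing function satisfy |f'(z,μ₂) − f'(z,μ₁)| ≤ (μ₂ − μ₁)/μ₂. -/
/-- Huber-type smoothing function: `f(z,μ) = |z|` if `|z| ≥ μ`, else `z²/(2μ) + μ/2`. -/
noncomputable def huber (μ z : ℝ) : ℝ := if μ ≤ |z| then |z| else z^2/(2*μ) + μ/2

/-- Derivative of `z ↦ huber μ z`: `sign z` if `|z| ≥ μ`, else `z/μ`. -/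
noncomputable def huberDeriv (μ z : ℝ) : ℝ := if μ ≤ |z| then Real.sign z else z/μ

theorem huberDeriv_neg (μ z : ℝ) : huberDeriv μ (-z) = -huberDeriv μ z := by
  unfold huberDeriv
  rw [abs_neg, Real.sign_neg, neg_div]
  split_ifs <;> rfl

theorem huberDeriv_of_nonneg {μ z : ℝ} (hμ : 0 < μ) (hz : 0 ≤ z) :
    huberDeriv μ z = min 1 (z / μ) := by
  unfold huberDeriv
  rw [abs_of_nonneg hz]
  split_ifs with h
  · rw [Real.sign_of_pos (hμ.trans_le h), min_eq_left ((one_le_div hμ).2 h)]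
  · rw [min_eq_right ((div_le_one hμ).2 (not_le.1 h).le)]

/-- for `0 < μ₁ ≤ μ₂` and all `z`, `|f'(z,μ₂) − f'(z,μ₁)| ≤ (μ₂ − μ₁)/μ₂`. -/
theorem huberDeriv_diff_le (μ₁ μ₂ : ℝ) (hμ₁ : 0 < μ₁) (hμ : μ₁ ≤ μ₂) (z : ℝ) :
    |huberDeriv μ₂ z - huberDeriv μ₁ z| ≤ (μ₂ - μ₁)/μ₂ := by
  wlog hz : 0 ≤ z generalizing z
  · have h := this (-z) (by linarith)
    rwa [huberDeriv_neg, huberDeriv_neg, ← neg_sub', abs_neg] at h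
  have hμ₂ : 0 < μ₂ := hμ₁.trans_le hμ
  have hmono : z / μ₂ ≤ z / μ₁ := div_le_div_of_nonneg_left hz hμ₁ hμ
  rw [huberDeriv_of_nonneg hμ₁ hz, huberDeriv_of_nonneg hμ₂ hz, abs_sub_comm,
    abs_of_nonneg (sub_nonneg.2 (min_le_min_left 1 hmono)), sub_div, div_self hμ₂.ne']
  -- With `t = z / μ₁` and `r = μ₁ / μ₂ ≤ 1`, the claim is `min 1 t - min 1 (t * r) ≤ 1 - r`.
  have hr : μ₁ / μ₂ ≤ 1 := (div_le_one hμ₂).2 hμ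
  have hr₀ : 0 < μ₁ / μ₂ := div_pos hμ₁ hμ₂
  have hprod : z / μ₂ = z / μ₁ * (μ₁ / μ₂) := by field_simp
  rw [hprod]
  rcases le_total 1 (z / μ₁) with h | h
  · have : μ₁ / μ₂ ≤ min 1 (z / μ₁ * (μ₁ / μ₂)) := le_min hr (by nlinarith)
    linarith [min_le_left 1 (z / μ₁)]
  · have h₀ : 0 ≤ z / μ₁ := div_nonneg hz hμ₁.le
    rw [min_eq_right h, min_eq_right (by nlinarith)]
    nlinarith
end

section
/- For every τ ∈ (0,1), every z ∈ ℝⁿ, and all 0 < μ₁ ≤ μ₂, one has ‖∇_z h(z,μ₂) − ∇_z h(z,μ₁)‖₂ ≤ (n/2)·(μ₂ − μ₁)/μ₂. -/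
/-- `h(z,μ) = (1/2)(Σᵢ f(zᵢ,μ) + (2τ−1) Σᵢ zᵢ)`. -/
noncomputable def hfun (n : ℕ) (τ μ : ℝ) (z : EuclideanSpace ℝ (Fin n)) : ℝ :=
  (1/2) * (∑ i, huber μ (z i) + (2*τ - 1) * ∑ i, z i)

theorem hasDerivAt_of_abs_sub_le_sq {f : ℝ → ℝ} {f' x C : ℝ}
    (h : ∀ y, |f y - f x - (y - x) * f'| ≤ C * (y - x) ^ 2) : HasDerivAt f f' x := by
  rw [hasDerivAt_iff_isLittleO]
  refine (Asymptotics.IsBigO.of_bound C (g := fun y => (y - x) ^ 2) ?_).trans_isLittleO ?_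
  · filter_upwards with y
    simpa using h y
  · have h2 := (Asymptotics.isLittleO_pow_id (𝕜 := ℝ) (n := 2) (by norm_num))
    have h3 : Filter.Tendsto (fun y : ℝ => y - x) (nhds x) (nhds 0) := by
      have : ContinuousAt (fun y : ℝ => y - x) x := by fun_prop
      simpa [ContinuousAt] using this
    exact h2.comp_tendsto h3

theorem hasDerivAt_max_zero_sq (x : ℝ) :
    HasDerivAt (fun y : ℝ => max y 0 ^ 2) (2 * max x 0) x := by
  refine hasDerivAt_of_abs_sub_le_sq (C := 1) fun y => ?_
  rw [abs_le]
  rcases max_cases y 0 with ⟨h1, h2⟩ | ⟨h1, h2⟩ <;>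
    rcases max_cases x 0 with ⟨h3, h4⟩ | ⟨h3, h4⟩ <;> rw [h1, h3] <;>
    constructor <;> nlinarith [sq_nonneg (y - x), sq_nonneg x, sq_nonneg y]

theorem huber_eq_sub_max_sq {μ : ℝ} (hμ : 0 < μ) (z : ℝ) :
    huber μ z = z ^ 2 / (2 * μ) + μ / 2
      - (max (z - μ) 0 ^ 2 + max (-z - μ) 0 ^ 2) / (2 * μ) := by
  unfold huber
  split_ifs with h
  · rcases abs_cases z with ⟨h1, h2⟩ | ⟨h1, h2⟩ <;> rw [h1] at h ⊢
    · rw [max_eq_left (by linarith), max_eq_right (by linarith)]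
      field_simp
      ring
    · rw [max_eq_right (by linarith), max_eq_left (by linarith)]
      field_simp
      ring
  · obtain ⟨h1, h2⟩ := abs_lt.mp (not_le.mp h)
    rw [max_eq_right (by linarith), max_eq_right (by linarith)]
    simp

theorem huberDeriv_eq_sub_max {μ : ℝ} (hμ : 0 < μ) (z : ℝ) :
    huberDeriv μ z = (z - max (z - μ) 0 + max (-z - μ) 0) / μ := by
  unfold huberDeriv
  split_ifs with h
  · rcases abs_cases z with ⟨h1, h2⟩ | ⟨h1, h2⟩ <;> rw [h1] at h
    · rw [max_eq_left (by linarith), max_eq_right (by linarith),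
        Real.sign_of_pos (by linarith)]
      field_simp
      ring
    · rw [max_eq_right (by linarith), max_eq_left (by linarith), Real.sign_of_neg h2]
      field_simp
      ring
  · obtain ⟨h1, h2⟩ := abs_lt.mp (not_le.mp h)
    rw [max_eq_right (by linarith), max_eq_right (by linarith)]
    simp

theorem hasDerivAt_huber {μ : ℝ} (hμ : 0 < μ) (z : ℝ) :
    HasDerivAt (huber μ) (huberDeriv μ z) z := by
  rw [funext (huber_eq_sub_max_sq hμ), huberDeriv_eq_sub_max hμ]
  have h1 := (hasDerivAt_max_zero_sq (z - μ)).comp z ((hasDerivAt_id z).sub_const μ)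
  have h2 := (hasDerivAt_max_zero_sq (-z - μ)).comp z ((hasDerivAt_id z).neg.sub_const μ)
  have h3 := (((hasDerivAt_id z).pow 2).div_const (2 * μ)).add_const (μ / 2)
  refine (h3.sub ((h1.add h2).div_const (2 * μ))).congr_deriv ?_
  simp only [id]
  field_simp
  ring

theorem abs_huberDeriv_sub_le {μ₁ μ₂ : ℝ} (hμ₁ : 0 < μ₁) (hμ : μ₁ ≤ μ₂) (z : ℝ) :
    |huberDeriv μ₂ z - huberDeriv μ₁ z| ≤ (μ₂ - μ₁) / μ₂ := by
  have hμ₂ : 0 < μ₂ := hμ₁.trans_le hμ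
  have h0 : 0 ≤ (μ₂ - μ₁) / μ₂ := div_nonneg (by linarith) hμ₂.le
  unfold huberDeriv
  split_ifs with h2 h1 h1
  · simpa using h0
  · linarith
  · have key : z / μ₂ - Real.sign z = (z - μ₂ * Real.sign z) / μ₂ := by field_simp
    rw [key, abs_div, abs_of_pos hμ₂]
    gcongr
    rw [not_le] at h2
    rcases abs_cases z with ⟨h3, h4⟩ | ⟨h3, h4⟩ <;> rw [h3] at h1 h2
    · rw [Real.sign_of_pos (by linarith), abs_le]
      constructor <;> linarith
    · rw [Real.sign_of_neg h4, abs_le]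
      constructor <;> linarith
  · have key : z / μ₂ - z / μ₁ = (-(z / μ₁) * (μ₂ - μ₁)) / μ₂ := by field_simp; ring
    rw [key, abs_div, abs_of_pos hμ₂, abs_mul, abs_neg, abs_of_nonneg (sub_nonneg.mpr hμ),
      abs_div, abs_of_pos hμ₁]
    gcongr
    refine mul_le_of_le_one_left (sub_nonneg.mpr hμ) ?_
    rw [div_le_one hμ₁]
    exact (not_le.mp h1).le

theorem hasGradientAt_hfun {n : ℕ} (τ : ℝ) {μ : ℝ} (hμ : 0 < μ)
    (z : EuclideanSpace ℝ (Fin n)) :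
    HasGradientAt (fun v => hfun n τ μ v)
      (WithLp.toLp 2 fun i => (1 / 2) * (huberDeriv μ (z i) + (2 * τ - 1))) z := by
  rw [hasGradientAt_iff_hasFDerivAt]
  have hp : ∀ i, HasFDerivAt (fun v : EuclideanSpace ℝ (Fin n) => v i)
      (EuclideanSpace.proj i : EuclideanSpace ℝ (Fin n) →L[ℝ] ℝ) z :=
    fun i => (EuclideanSpace.proj i : EuclideanSpace ℝ (Fin n) →L[ℝ] ℝ).hasFDerivAt
  have h1 := HasFDerivAt.fun_sum (u := Finset.univ)
    fun i _ => (hasDerivAt_huber hμ (z i)).comp_hasFDerivAt z (hp i)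
  have h2 := HasFDerivAt.fun_sum (u := Finset.univ) fun i _ => hp i
  refine ((h1.add (h2.const_mul (2 * τ - 1))).const_mul (1 / 2)).congr_fderiv ?_
  ext v
  simp [PiLp.inner_apply, Finset.mul_sum, ← Finset.sum_add_distrib]
  refine Finset.sum_congr rfl fun i _ => ?_
  ring

theorem EuclideanSpace.norm_le_sum_abs {ι : Type*} [Fintype ι] (v : EuclideanSpace ℝ ι) :
    ‖v‖ ≤ ∑ i, |v i| := by
  rw [EuclideanSpace.norm_eq]
  refine Real.sqrt_le_iff.mpr ⟨Finset.sum_nonneg fun i _ => abs_nonneg _, ?_⟩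
  exact Finset.sum_sq_le_sq_sum_of_nonneg fun i _ => abs_nonneg _

/-- for `τ ∈ (0,1)`, `z ∈ ℝⁿ` and `0 < μ₁ ≤ μ₂`,
`‖∇_z h(z,μ₂) − ∇_z h(z,μ₁)‖₂ ≤ (n/2)·(μ₂ − μ₁)/μ₂`. -/
theorem hfun_gradient_diff_in_mu (n : ℕ) (τ : ℝ) (hτ : τ ∈ Set.Ioo (0:ℝ) 1)
    (z : EuclideanSpace ℝ (Fin n)) (μ₁ μ₂ : ℝ) (hμ₁ : 0 < μ₁) (hμ : μ₁ ≤ μ₂) :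
    ‖gradient (fun v => hfun n τ μ₂ v) z - gradient (fun v => hfun n τ μ₁ v) z‖ ≤
      (n/2) * ((μ₂ - μ₁)/μ₂) := by
  rw [(hasGradientAt_hfun τ (hμ₁.trans_le hμ) z).gradient, (hasGradientAt_hfun τ hμ₁ z).gradient]
  refine (EuclideanSpace.norm_le_sum_abs _).trans ?_
  calc _ ≤ ∑ _i : Fin n, (1 / 2) * ((μ₂ - μ₁) / μ₂) := by
        refine Finset.sum_le_sum fun i _ => ?_
        rw [PiLp.sub_apply, ← mul_sub, add_sub_add_right_eq_sub, abs_mul,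
          abs_of_pos (by norm_num : (0 : ℝ) < 1 / 2)]
        gcongr
        exact abs_huberDeriv_sub_le hμ₁ hμ (z i)
    _ = (n/2) * ((μ₂ - μ₁)/μ₂) := by
        simp
        ring
end

section
/- The smoothing function f is (1/2)-Lipschitz in the smoothing parameter: for all z ∈ ℝ and all μ₁, μ₂ > 0, |f(z,μ₁) − f(z,μ₂)| ≤ (1/2)|μ₁ − μ₂|. -/
/-- The smoothing function only sees the smoothing parameter through `max μ |z|`. -/
lemma huber_eq_max {μ : ℝ} (hμ : 0 < μ) (z : ℝ) :
    huber μ z = z ^ 2 / (2 * max μ |z|) + max μ |z| / 2 := by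
  unfold huber
  split_ifs with h
  · have hz : |z| ≠ 0 := (hμ.trans_le h).ne'
    rw [max_eq_right h, ← sq_abs z]
    field_simp
    ring
  · rw [max_eq_left (not_le.mp h).le]

lemma abs_sq_div_add_half_sub_le {z a b : ℝ} (ha : 0 < a) (hb : 0 < b)
    (hza : |z| ≤ a) (hzb : |z| ≤ b) :
    |(z ^ 2 / (2 * a) + a / 2) - (z ^ 2 / (2 * b) + b / 2)| ≤ (1 / 2) * |a - b| := by
  have hfactor : (z ^ 2 / (2 * a) + a / 2) - (z ^ 2 / (2 * b) + b / 2)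
      = (1 / 2) * (a - b) * (1 - z ^ 2 / (a * b)) := by
    field_simp
    ring
  have hle : z ^ 2 / (a * b) ≤ 1 := by
    rw [div_le_one (mul_pos ha hb), ← sq_abs, sq]
    exact mul_le_mul hza hzb (abs_nonneg z) ha.le
  have hnonneg : 0 ≤ z ^ 2 / (a * b) := by positivity
  have hbound : |1 - z ^ 2 / (a * b)| ≤ 1 := abs_le.mpr ⟨by linarith, by linarith⟩
  rw [hfactor, abs_mul, abs_mul, abs_of_pos (one_half_pos (α := ℝ))]
  exact mul_le_of_le_one_right (by positivity) hbound

/-- `f` is `(1/2)`-Lipschitz in the smoothing parameter: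
for all `z` and `μ₁, μ₂ > 0`, `|f(z,μ₁) − f(z,μ₂)| ≤ (1/2)|μ₁ − μ₂|`. -/
theorem huber_lipschitz_in_mu (z μ₁ μ₂ : ℝ) (hμ₁ : 0 < μ₁) (hμ₂ : 0 < μ₂) :
    |huber μ₁ z - huber μ₂ z| ≤ (1/2) * |μ₁ - μ₂| := by
  rw [huber_eq_max hμ₁, huber_eq_max hμ₂]
  refine (abs_sq_div_add_half_sub_le (lt_max_of_lt_left hμ₁) (lt_max_of_lt_left hμ₂)
    (le_max_right _ _) (le_max_right _ _)).trans ?_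
  exact mul_le_mul_of_nonneg_left (abs_max_sub_max_le_abs μ₁ μ₂ |z|) one_half_pos.le
end

section
/- Suppose the penalty P : ℝ^P → ℝ is nonnegative and τ ∈ (0,1). If Ψ ∈ ℝⁿ has every component in the interval [τ−1, τ], then for every σ > 0, μ > 0, w ∈ ℝ^P and z ∈ ℝⁿ, the smoothed augmented Lagrangian is lower bounded: L̄_{σ,μ}(w,z,Ψ) ≥ −(n/(2σ))·max(τ, 1−τ)². -/
/-- Reinterpret a vector in `Fin n → ℝ` as an element of Euclidean space (ℓ² norm). -/
noncomputable def toE {n : ℕ} (v : Fin n → ℝ) : EuclideanSpace ℝ (Fin n) :=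
  (WithLp.equiv 2 (Fin n → ℝ)).symm v

open scoped RealInnerProductSpace in
/-- Smoothed augmented Lagrangian
`L̄_{σ,μ}(w,z,Ψ) = h(z,μ) + n·P(w) + Ψᵀ(z + Xw − y) + (σ/2)‖z + Xw − y‖₂²`. -/
noncomputable def lagr (n P : ℕ) (X : Matrix (Fin n) (Fin P) ℝ) (y : EuclideanSpace ℝ (Fin n))
    (τ : ℝ) (Pen : EuclideanSpace ℝ (Fin P) → ℝ) (σ μ : ℝ)
    (w : EuclideanSpace ℝ (Fin P)) (z Ψ : EuclideanSpace ℝ (Fin n)) : ℝ :=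
  hfun n τ μ z + n * Pen w + ⟪Ψ, z + toE (X.mulVec w) - y⟫
    + σ/2 * ‖z + toE (X.mulVec w) - y‖^2

/-- The smoothing majorizes the absolute value. -/
theorem abs_le_huber {μ : ℝ} (hμ : 0 < μ) (z : ℝ) : |z| ≤ huber μ z := by
  unfold huber
  split_ifs
  · exact le_rfl
  · have h : z ^ 2 / (2 * μ) + μ / 2 - |z| = (|z| - μ) ^ 2 / (2 * μ) := by
      rw [← sq_abs z]
      field_simp
      ring
    have : 0 ≤ (|z| - μ) ^ 2 / (2 * μ) := by positivity
    linarith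

theorem hfun_nonneg {n : ℕ} {τ μ : ℝ} (hτ : τ ∈ Set.Icc (0 : ℝ) 1) (hμ : 0 < μ)
    (z : EuclideanSpace ℝ (Fin n)) : 0 ≤ hfun n τ μ z := by
  unfold hfun
  rw [Finset.mul_sum, ← Finset.sum_add_distrib]
  refine mul_nonneg (by norm_num) (Finset.sum_nonneg fun i _ => ?_)
  have h := abs_le_huber hμ (z i)
  rcases abs_cases (z i) with ⟨h₁, h₂⟩ | ⟨h₁, h₂⟩ <;> nlinarith [hτ.1, hτ.2]

open scoped RealInnerProductSpace in
/-- Completing the square: the minimum over `r` of `⟪x, r⟫ + (σ/2)‖r‖²` is `-‖x‖²/(2σ)`. -/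
theorem neg_norm_sq_div_le_inner_add {E : Type*} [NormedAddCommGroup E] [InnerProductSpace ℝ E]
    {σ : ℝ} (hσ : 0 < σ) (x r : E) :
    -(‖x‖ ^ 2 / (2 * σ)) ≤ ⟪x, r⟫ + σ / 2 * ‖r‖ ^ 2 := by
  have h : ⟪x, r⟫ + σ / 2 * ‖r‖ ^ 2 + ‖x‖ ^ 2 / (2 * σ) = ‖x + σ • r‖ ^ 2 / (2 * σ) := by
    rw [norm_add_sq_real, inner_smul_right, norm_smul, Real.norm_of_nonneg hσ.le]
    field_simp
    ring
  have : 0 ≤ ‖x + σ • r‖ ^ 2 / (2 * σ) := by positivity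
  linarith

theorem EuclideanSpace.norm_sq_le_card_mul_sq {ι : Type*} [Fintype ι] {x : EuclideanSpace ℝ ι}
    {M : ℝ} (h : ∀ i, |x i| ≤ M) : ‖x‖ ^ 2 ≤ Fintype.card ι * M ^ 2 := by
  rw [EuclideanSpace.real_norm_sq_eq]
  calc ∑ i, x i ^ 2 ≤ ∑ _i : ι, M ^ 2 :=
        Finset.sum_le_sum fun i _ => sq_le_sq' (abs_le.1 (h i)).1 (abs_le.1 (h i)).2
    _ = Fintype.card ι * M ^ 2 := by simp

/-- if the penalty `P` is nonnegative, `τ ∈ (0,1)` and every component of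
`Ψ` lies in `[τ−1, τ]`, then for all `σ, μ > 0`, `w`, `z`:
`L̄_{σ,μ}(w,z,Ψ) ≥ −(n/(2σ))·max(τ, 1−τ)²`. -/
theorem lagr_lower_bounded (n P : ℕ) (X : Matrix (Fin n) (Fin P) ℝ)
    (y : EuclideanSpace ℝ (Fin n)) (τ : ℝ) (hτ : τ ∈ Set.Ioo (0:ℝ) 1)
    (Pen : EuclideanSpace ℝ (Fin P) → ℝ) (hPen : ∀ w, 0 ≤ Pen w)
    (Ψ : EuclideanSpace ℝ (Fin n)) (hΨ : ∀ i, Ψ i ∈ Set.Icc (τ - 1) τ)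
    (σ μ : ℝ) (hσ : 0 < σ) (hμ : 0 < μ)
    (w : EuclideanSpace ℝ (Fin P)) (z : EuclideanSpace ℝ (Fin n)) :
    -((n/(2*σ)) * (max τ (1 - τ))^2) ≤ lagr n P X y τ Pen σ μ w z Ψ := by
  have hΨM : ‖Ψ‖ ^ 2 ≤ n * max τ (1 - τ) ^ 2 := by
    simpa using EuclideanSpace.norm_sq_le_card_mul_sq (x := Ψ) (M := max τ (1 - τ)) fun i =>
      abs_le.2 ⟨by linarith [(hΨ i).1, le_max_right τ (1 - τ)],
        (hΨ i).2.trans (le_max_left _ _)⟩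
  have hdiv : ‖Ψ‖ ^ 2 / (2 * σ) ≤ n / (2 * σ) * max τ (1 - τ) ^ 2 := by
    rw [div_mul_eq_mul_div]
    gcongr
  have hsq := neg_norm_sq_div_le_inner_add hσ Ψ (z + toE (X.mulVec w) - y)
  have hh := hfun_nonneg (Set.Ioo_subset_Icc_self hτ) hμ z
  have hP : 0 ≤ n * Pen w := mul_nonneg n.cast_nonneg (hPen w)
  unfold lagr
  linarith
end

section
/- For every μ > 0, ρ > 0 and x ∈ ℝ, the function z ↦ f(z,μ) + (1/(2ρ))(z − x)² has a unique minimizer over ℝ, given by the closed-form proximal formula: the minimizer equals x − ρ if x ≥ ρ + μ; equals x/(1 + ρ/μ) if −(ρ + μ) < x < ρ + μ; and equals x + ρ if x ≤ −(ρ + μ). -/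
/-- Affine minorants of the Huber function with slope `g ∈ [-1, 1]`. -/
theorem affine_le_huber {μ g : ℝ} (hμ : 0 < μ) (hg : |g| ≤ 1) (z : ℝ) :
    g * z + μ / 2 * (1 - g ^ 2) ≤ huber μ z := by
  unfold huber
  split_ifs with h
  · have hgz : g * z ≤ |g| * |z| := (le_abs_self _).trans (abs_mul g z).le
    have hz : μ * (1 - |g|) ≤ |z| * (1 - |g|) :=
      mul_le_mul_of_nonneg_right h (sub_nonneg.2 hg)
    rw [← sq_abs g]
    nlinarith [mul_nonneg hμ.le (sq_nonneg (1 - |g|))]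
  · have hsq : z ^ 2 / (2 * μ) + μ / 2 - (g * z + μ / 2 * (1 - g ^ 2))
        = (z - μ * g) ^ 2 / (2 * μ) := by
      field_simp
      ring
    have : 0 ≤ (z - μ * g) ^ 2 / (2 * μ) := by positivity
    linarith

/-- Quadratic growth of the proximal objective around a point `m` at which an affine minorant
with slope `g` is attained and `m + ρ * g = x`. -/
theorem huber_prox_quadratic_growth {μ ρ x m g : ℝ} (hμ : 0 < μ) (hρ : 0 < ρ) (hg : |g| ≤ 1)
    (hm : huber μ m = g * m + μ / 2 * (1 - g ^ 2)) (hx : m + ρ * g = x) (z : ℝ) :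
    huber μ m + 1 / (2 * ρ) * (m - x) ^ 2 + 1 / (2 * ρ) * (z - m) ^ 2
      ≤ huber μ z + 1 / (2 * ρ) * (z - x) ^ 2 := by
  have hexp : 1 / (2 * ρ) * (z - x) ^ 2
      = 1 / (2 * ρ) * (m - x) ^ 2 + 1 / (2 * ρ) * (z - m) ^ 2 - g * (z - m) := by
    subst hx
    field_simp
    ring
  linarith [affine_le_huber hμ hg z]

/-- The proximal formula gives a point satisfying the optimality condition. -/
theorem exists_slope_huber_prox {μ ρ x m : ℝ} (hμ : 0 < μ) (hρ : 0 < ρ)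
    (hm : m = if ρ + μ ≤ x then x - ρ else if x ≤ -(ρ + μ) then x + ρ else x / (1 + ρ / μ)) :
    ∃ g : ℝ, |g| ≤ 1 ∧ huber μ m = g * m + μ / 2 * (1 - g ^ 2) ∧ m + ρ * g = x := by
  split_ifs at hm with h₁ h₂
  · have hμm : μ ≤ m := by linarith
    have habs : |m| = m := abs_of_nonneg (hμ.le.trans hμm)
    refine ⟨1, by simp, ?_, by linarith⟩
    rw [huber, habs, if_pos hμm]
    ring
  · have hmμ : μ ≤ -m := by linarith
    have habs : |m| = -m := abs_of_nonpos (by linarith)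
    refine ⟨-1, by simp, ?_, by linarith⟩
    rw [huber, habs, if_pos hmμ]
    ring
  · have hx : m + ρ * (m / μ) = x := by
      rw [hm]
      field_simp
    have hmul : m * (μ + ρ) = x * μ := by
      rw [← hx]
      field_simp
    have habs : |m| < μ := by
      rw [abs_lt]
      constructor <;> nlinarith
    refine ⟨m / μ, ?_, ?_, hx⟩
    · rw [abs_div, abs_of_pos hμ]
      exact (div_le_one hμ).2 habs.le
    · rw [huber, if_neg habs.not_ge]
      field_simp
      ring

/-- for `μ, ρ > 0` and `x ∈ ℝ`, the function
`z ↦ f(z,μ) + (1/(2ρ))(z − x)²` has a unique minimizer over `ℝ`, given by the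
closed-form proximal formula: `x − ρ` if `x ≥ ρ + μ`; `x/(1 + ρ/μ)` if
`−(ρ+μ) < x < ρ+μ`; and `x + ρ` if `x ≤ −(ρ+μ)`. -/
theorem huber_prox_formula (μ ρ x : ℝ) (hμ : 0 < μ) (hρ : 0 < ρ)
    (F : ℝ → ℝ) (hF : F = fun z => huber μ z + (1/(2*ρ)) * (z - x)^2)
    (m : ℝ)
    (hm : m = if ρ + μ ≤ x then x - ρ else if x ≤ -(ρ + μ) then x + ρ else x/(1 + ρ/μ)) :
    IsMinOn F Set.univ m ∧ ∀ z : ℝ, IsMinOn F Set.univ z → z = m := by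
  subst hF
  obtain ⟨g, hg, hgm, hx⟩ := exists_slope_huber_prox hμ hρ hm
  have growth := huber_prox_quadratic_growth hμ hρ hg hgm hx
  refine ⟨fun z _ => ?_, fun z hz => ?_⟩
  · have : 0 ≤ 1 / (2 * ρ) * (z - m) ^ 2 := by positivity
    exact (le_add_of_nonneg_right this).trans (growth z)
  · have hle : huber μ z + 1 / (2 * ρ) * (z - x) ^ 2
        ≤ huber μ m + 1 / (2 * ρ) * (m - x) ^ 2 := hz (Set.mem_univ m)
    by_contra hne
    have : 0 < 1 / (2 * ρ) * (z - m) ^ 2 := by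
      have := sub_ne_zero.2 hne
      positivity
    linarith [growth z]
end

section
/- For every λ > 0 and γ ≥ 2, the SCAD penalty is 1/(γ−1)-weakly convex: the function w ↦ g^{SCAD}_{λ,γ}(w) + w²/(2(γ−1)) is convex on ℝ. -/
/-- SCAD penalty: `λ|w|` if `|w| ≤ λ`; `−(w² − 2γλ|w| + λ²)/(2(γ−1))` if `λ < |w| ≤ γλ`;
`(γ+1)λ²/2` if `|w| > γλ`. -/
noncomputable def scad (lam γ w : ℝ) : ℝ :=
  if |w| ≤ lam then lam*|w|
  else if |w| ≤ γ*lam then -(w^2 - 2*γ*lam*|w| + lam^2)/(2*(γ-1))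
  else (γ+1)*lam^2/2

/-- The function of `|w|` that equals the SCAD penalty plus `w²/(2(γ−1))`, scaled by `2(γ−1)`. -/
noncomputable def scadProfile (lam γ t : ℝ) : ℝ :=
  2*γ*lam*t - lam^2 + (max (lam - t) 0)^2 + (max (t - γ*lam) 0)^2

theorem scad_add_sq_eq {lam γ : ℝ} (hlam : 0 < lam) (hγ : 1 < γ) (w : ℝ) :
    scad lam γ w + w^2/(2*(γ-1)) = (2*(γ-1))⁻¹ * scadProfile lam γ |w| := by
  have hγ' : γ - 1 ≠ 0 := by linarith
  have hle : lam ≤ γ*lam := by nlinarith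
  unfold scad scadProfile
  rw [← sq_abs w]
  generalize |w| = t
  split_ifs with h₁ h₂
  · rw [max_eq_left (by linarith), max_eq_right (by linarith)]
    field_simp
    ring
  · rw [max_eq_right (by linarith), max_eq_right (by linarith)]
    field_simp
    ring
  · rw [max_eq_right (by linarith), max_eq_left (by linarith)]
    field_simp
    ring

theorem convexOn_scadProfile (lam γ : ℝ) : ConvexOn ℝ Set.univ (scadProfile lam γ) := by
  have hlin (a b : ℝ) : ConvexOn ℝ Set.univ (fun t : ℝ => a*t + b) :=
    ⟨convex_univ, fun x _ y _ p q _ _ hpq => le_of_eq <| by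
      simp only [smul_eq_mul]
      linear_combination (-b) * hpq⟩
  have hsq (a b : ℝ) : ConvexOn ℝ Set.univ (fun t : ℝ => (max (a*t + b) 0)^2) :=
    ((hlin a b).sup (convexOn_const 0 convex_univ)).pow (fun _ _ => le_max_right _ _) 2
  refine (((hlin (2*γ*lam) (-lam^2)).add (hsq (-1) lam)).add (hsq 1 (-(γ*lam)))).congr ?_
  intro t _
  simp only [scadProfile, Pi.add_apply]
  ring_nf

theorem monotoneOn_scadProfile {lam γ : ℝ} (hlam : 0 ≤ lam) (hγ : 1 ≤ γ) :
    MonotoneOn (scadProfile lam γ) (Set.Ici 0) := by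
  intro x hx y _ hxy
  rw [Set.mem_Ici] at hx
  have hright : (max (x - γ*lam) 0)^2 ≤ (max (y - γ*lam) 0)^2 := by gcongr
  have hslope : lam*(y - x) ≤ γ*lam*(y - x) := by
    have := mul_nonneg hlam (sub_nonneg.2 hxy)
    nlinarith
  have hleft : 2*lam*x + (max (lam - x) 0)^2 ≤ 2*lam*y + (max (lam - y) 0)^2 := by
    rcases max_cases (lam - x) 0 with ⟨h, _⟩ | ⟨h, _⟩ <;>
    rcases max_cases (lam - y) 0 with ⟨h', _⟩ | ⟨h', _⟩ <;>
    rw [h, h'] <;> nlinarith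
  unfold scadProfile
  linarith

/-- for `λ > 0` and `γ ≥ 2`, the SCAD penalty is `1/(γ−1)`-weakly convex:
`w ↦ g^{SCAD}_{λ,γ}(w) + w²/(2(γ−1))` is convex on `ℝ`. -/
theorem scad_weakly_convex (lam γ : ℝ) (hlam : 0 < lam) (hγ : 2 ≤ γ) :
    ConvexOn ℝ Set.univ (fun w : ℝ => scad lam γ w + w^2/(2*(γ-1))) := by
  have habs : ConvexOn ℝ Set.univ (fun w : ℝ => |w|) := convexOn_univ_norm
  have himage : (fun w : ℝ => |w|) '' Set.univ = Set.Ici 0 := by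
    ext t
    exact ⟨fun ⟨w, _, hw⟩ => hw ▸ abs_nonneg w, fun ht => ⟨t, trivial, abs_of_nonneg ht⟩⟩
  have hcomp : ConvexOn ℝ Set.univ (scadProfile lam γ ∘ fun w : ℝ => |w|) := by
    refine ConvexOn.comp ?_ habs ?_ <;> rw [himage]
    · exact (convexOn_scadProfile lam γ).subset (Set.subset_univ _) (convex_Ici 0)
    · exact monotoneOn_scadProfile hlam.le (by linarith)
  have hscale : 0 ≤ (2*(γ-1))⁻¹ := inv_nonneg.2 (by linarith)
  exact (hcomp.smul hscale).congr fun w _ => (scad_add_sq_eq hlam (by linarith) w).symm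
end
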